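/- arXiv:1509.02743 — 2 statements merged into one kernel-verified Lean document; each statement's English description precedes it below -/
import Mathlib

section
/- Let ℓ be a prime, Λ = Zℓ[[X]], T a finitely generated Λ-module, and F a Λ-submodule of T which is finite as a set. Then there exists N such that for all n ≥ N one has F ∩ ω_n·T = 0, where ω_n = (1+X)^{ℓ^n} − 1. (This is the step in the proof of Theorem 10 of the paper showing that the capitulation kernel is ultimately isomorphic to the maximal finite submodule F.) -/
/-- The element `ω_n = (1+X)^(ℓ^n) - 1` of `Λ = ℤℓ[[X]]`. -/
noncomputable def omega (ℓ : ℕ) [Fact (Nat.Prime ℓ)] (n : ℕ) : PowerSeries ℤ_[ℓ] :=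
  (1 + PowerSeries.X) ^ ℓ ^ n - 1

open IsLocalRing in
/-- In a local ring whose residue characteristic is `p`, the `p ^ n`-th power of an element
congruent to `1` modulo the maximal ideal is congruent to `1` modulo its `(n + 1)`-st power. -/
theorem IsLocalRing.one_add_pow_prime_pow_sub_one_mem {R : Type*} [CommRing R] [IsLocalRing R]
    {p : ℕ} (hp : (p : R) ∈ maximalIdeal R) {x : R} (hx : x ∈ maximalIdeal R) (n : ℕ) :
    (1 + x) ^ p ^ n - 1 ∈ maximalIdeal R ^ (n + 1) := by
  induction n with
  | zero => simpa using hx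
  | succ n ih =>
    set y := (1 + x) ^ p ^ n with hy
    have hy1 : y - 1 ∈ maximalIdeal R := Ideal.pow_le_self n.succ_ne_zero ih
    have hsum : ∑ i ∈ Finset.range p, y ^ i ∈ maximalIdeal R := by
      have hdiff : ∑ i ∈ Finset.range p, (y ^ i - 1) ∈ maximalIdeal R :=
        Ideal.sum_mem _ fun i _ => Ideal.mem_of_dvd _ (sub_one_dvd_pow_sub_one y i) hy1
      simpa [Finset.sum_sub_distrib] using add_mem hdiff hp
    rw [pow_succ p, pow_mul, ← hy, ← geom_sum_mul, mul_comm, pow_succ _ (n + 1)]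
    exact Ideal.mul_mem_mul ih hsum

/-- A finite submodule of a finitely generated module over a Noetherian local ring meets
`I ^ n • ⊤` trivially for all large `n`. -/
theorem Ideal.eventually_inf_pow_smul_top_eq_bot {R M : Type*} [CommRing R] [IsNoetherianRing R]
    [IsLocalRing R] [AddCommGroup M] [Module R M] [Module.Finite R M] {I : Ideal R} (hI : I ≠ ⊤)
    (F : Submodule R M) (hF : (F : Set M).Finite) :
    ∀ᶠ n in Filter.atTop, F ⊓ I ^ n • (⊤ : Submodule R M) = ⊥ := by
  have h : ∀ x ∈ (F : Set M), ∀ᶠ n in Filter.atTop,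
      x ∈ I ^ n • (⊤ : Submodule R M) → x = 0 := by
    intro x _
    by_cases hx : x = 0
    · exact .of_forall fun _ _ => hx
    have hmem : x ∉ ⨅ n : ℕ, I ^ n • (⊤ : Submodule R M) := by
      rwa [I.iInf_pow_smul_eq_bot_of_isLocalRing hI, Submodule.mem_bot]
    obtain ⟨k, hk⟩ : ∃ k : ℕ, x ∉ I ^ k • (⊤ : Submodule R M) := by
      simpa [Submodule.mem_iInf] using hmem
    filter_upwards [Filter.eventually_ge_atTop k] with n hn hxn
    exact absurd (Submodule.smul_mono_left (Ideal.pow_le_pow_right hn) hxn) hk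
  filter_upwards [(Filter.eventually_all_finite hF).2 h] with n hn
  exact (Submodule.eq_bot_iff _).2 fun x hx => hn x hx.1 hx.2

open IsLocalRing in
theorem omega_mem_maximalIdeal_pow (ℓ : ℕ) [Fact (Nat.Prime ℓ)] (n : ℕ) :
    omega ℓ n ∈ maximalIdeal (PowerSeries ℤ_[ℓ]) ^ (n + 1) := by
  refine one_add_pow_prime_pow_sub_one_mem ?_ ?_ n <;>
    rw [mem_maximalIdeal, mem_nonunits_iff, PowerSeries.isUnit_iff_constantCoeff]
  · simpa using PadicInt.p_nonunit (p := ℓ)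
  · simp

/-- Let `ℓ` be a prime, `Λ = ℤℓ[[X]]`, `T` a finitely generated `Λ`-module and
`F` a `Λ`-submodule of `T` which is finite as a set.  Then there exists `N`
such that for all `n ≥ N` one has `F ∩ ω_n • T = 0`, where
`ω_n = (1+X)^(ℓ^n) - 1`. -/
theorem stmt3 (ℓ : ℕ) [Fact (Nat.Prime ℓ)]
    (T : Type) [AddCommGroup T] [Module (PowerSeries ℤ_[ℓ]) T]
    [Module.Finite (PowerSeries ℤ_[ℓ]) T]
    (F : Submodule (PowerSeries ℤ_[ℓ]) T) (hF : (F : Set T).Finite) :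
    ∃ N : ℕ, ∀ n ≥ N,
      F ⊓ (Ideal.span {omega ℓ n} • (⊤ : Submodule (PowerSeries ℤ_[ℓ]) T)) = ⊥ := by
  obtain ⟨N, hN⟩ := Filter.eventually_atTop.1
    (Ideal.eventually_inf_pow_smul_top_eq_bot (IsLocalRing.maximalIdeal.isMaximal _).ne_top F hF)
  refine ⟨N, fun n hn => eq_bot_iff.2 ?_⟩
  rw [← hN (n + 1) (by omega)]
  exact inf_le_inf_left F (Submodule.smul_mono_left
    ((Ideal.span_singleton_le_iff_mem _).2 (omega_mem_maximalIdeal_pow ℓ n)))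
end

section
/- Let ℓ be a prime, Λ = Zℓ[[X]], and T a finitely generated torsion Λ-module with largest finite submodule F. Then there exists N such that for all m ≥ n ≥ N, every element t ∈ T with ν_{n,m}·t = 0 lies in F; that is, T[ν_{n,m}] ⊆ F. (This is the key fact, used in the proof of Theorem 10 of the paper, that for m ≥ n ≫ 0 the elements ω_m/ω_n are coprime to the characteristic polynomial of T.) -/
open Pointwise

/-- The element `ν_{n,m} = ∑_{j=0}^{ℓ^(m-n)-1} (1+X)^(j·ℓ^n)` of `Λ = ℤℓ[[X]]`. -/
noncomputable def nu (ℓ : ℕ) [Fact (Nat.Prime ℓ)] (n m : ℕ) : PowerSeries ℤ_[ℓ] :=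
  ∑ j ∈ Finset.range (ℓ ^ (m - n)), (1 + PowerSeries.X) ^ (j * ℓ ^ n)

open PowerSeries in
/-- The ring `ℤℓ[[X]] / (ℓ^k, X^M)` is finite. -/
theorem finite_quotient_span_pow_X_pow (ℓ : ℕ) [Fact (Nat.Prime ℓ)] (k M : ℕ) :
    Finite (ℤ_[ℓ]⟦X⟧ ⧸ Ideal.span {(ℓ : ℤ_[ℓ]⟦X⟧) ^ k, X ^ M}) := by
  set I : Ideal ℤ_[ℓ]⟦X⟧ := Ideal.span {(ℓ : ℤ_[ℓ]⟦X⟧) ^ k, X ^ M}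
  have : NeZero (ℓ ^ k) := ⟨pow_ne_zero _ (Fact.out : ℓ.Prime).ne_zero⟩
  let φ : (ℤ_[ℓ]⟦X⟧ ⧸ I) → Fin M → ZMod (ℓ ^ k) := fun q i ↦
    PadicInt.toZModPow k (coeff i (Quotient.out q))
  refine Finite.of_injective φ fun a b hab ↦ ?_
  rw [← Ideal.Quotient.mk_out a, ← Ideal.Quotient.mk_out b, Ideal.Quotient.eq]
  set f : ℤ_[ℓ]⟦X⟧ := Quotient.out a - Quotient.out b
  have hcoeff : Polynomial.C ((ℓ : ℤ_[ℓ]) ^ k) ∣ trunc M f := by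
    rw [Polynomial.C_dvd_iff_dvd_coeff]
    intro i
    rw [coeff_trunc]
    split_ifs with hi
    · rw [← Ideal.mem_span_singleton, ← PadicInt.ker_toZModPow, RingHom.mem_ker, map_sub,
        map_sub, sub_eq_zero]
      exact congrFun hab ⟨i, hi⟩
    · exact dvd_zero _
  obtain ⟨g, hg⟩ := hcoeff
  rw [eq_X_pow_mul_shift_add_trunc M f, hg]
  refine I.add_mem (I.mul_mem_right _ (Ideal.subset_span (by simp))) ?_
  rw [Polynomial.coe_mul]
  refine I.mul_mem_right _ (Ideal.subset_span ?_)
  exact Or.inl (by rw [Polynomial.coe_C, map_pow, map_natCast])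

/-- A finitely generated module over `R` killed by `I` is finite if `R ⧸ I` is. -/
theorem finite_of_isTorsionBySet {R M : Type*} [CommRing R] [AddCommGroup M] [Module R M]
    [Module.Finite R M] (I : Ideal R) [Finite (R ⧸ I)] (h : Module.IsTorsionBySet R M I) :
    Finite M := by
  let := h.module
  have : IsScalarTower R (R ⧸ I) M := h.isScalarTower
  have := Module.Finite.of_restrictScalars_finite R (R ⧸ I) M
  exact Module.finite_of_finite (R ⧸ I)

theorem omega_dvd_omega (ℓ : ℕ) [Fact (Nat.Prime ℓ)] {n m : ℕ} (h : n ≤ m) :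
    omega ℓ n ∣ omega ℓ m := by
  obtain ⟨d, rfl⟩ := Nat.exists_eq_add_of_le h
  rw [omega, omega, pow_add, pow_mul]
  exact sub_one_dvd_pow_sub_one _ _

theorem nu_mul_omega (ℓ : ℕ) [Fact (Nat.Prime ℓ)] {n m : ℕ} (h : n ≤ m) :
    nu ℓ n m * omega ℓ n = omega ℓ m := by
  simp only [nu, omega, mul_comm _ (ℓ ^ n), pow_mul]
  rw [geom_sum_mul, ← pow_mul, ← pow_add, Nat.add_sub_cancel' h]

theorem omega_dvd_nu_sub (ℓ : ℕ) [Fact (Nat.Prime ℓ)] (n m : ℕ) :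
    omega ℓ n ∣ nu ℓ n m - (ℓ : PowerSeries ℤ_[ℓ]) ^ (m - n) := by
  have : nu ℓ n m - (ℓ : PowerSeries ℤ_[ℓ]) ^ (m - n) =
      ∑ j ∈ Finset.range (ℓ ^ (m - n)),
        (((1 + PowerSeries.X : PowerSeries ℤ_[ℓ]) ^ ℓ ^ n) ^ j - 1) := by
    simp [nu, ← pow_mul, mul_comm]
  rw [this]
  exact Finset.dvd_sum fun j _ ↦ sub_one_dvd_pow_sub_one _ _

open PowerSeries in
theorem X_pow_mem_span_omega_pow (ℓ : ℕ) [Fact (Nat.Prime ℓ)] (n k : ℕ) :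
    (X : ℤ_[ℓ]⟦X⟧) ^ (ℓ ^ n * k) ∈ Ideal.span {omega ℓ n, (ℓ : ℤ_[ℓ]⟦X⟧) ^ k} := by
  obtain ⟨r, hr⟩ := exists_add_pow_prime_pow_eq (Fact.out : ℓ.Prime) 1 (X : ℤ_[ℓ]⟦X⟧) n
  have hX : (X : ℤ_[ℓ]⟦X⟧) ^ ℓ ^ n - (-((ℓ : ℤ_[ℓ]⟦X⟧) * (X * r))) = omega ℓ n := by
    rw [omega, hr]
    ring
  obtain ⟨s, hs⟩ := sub_dvd_pow_sub_pow ((X : ℤ_[ℓ]⟦X⟧) ^ ℓ ^ n) (-((ℓ : ℤ_[ℓ]⟦X⟧) * (X * r))) k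
  rw [hX] at hs
  rw [Ideal.mem_span_pair]
  refine ⟨s, (-(X * r)) ^ k, ?_⟩
  rw [pow_mul, ← mul_pow, mul_comm s, ← hs]
  ring

/-- A finitely generated `ℤℓ[[X]]`-module killed by `ω_n` and a power of `ℓ` is finite. -/
theorem finite_of_omega_smul_of_pow_smul (ℓ : ℕ) [Fact (Nat.Prime ℓ)] {M : Type*} [AddCommGroup M]
    [Module (PowerSeries ℤ_[ℓ]) M] [Module.Finite (PowerSeries ℤ_[ℓ]) M] (n k : ℕ)
    (hω : ∀ x : M, omega ℓ n • x = 0) (hℓ : ∀ x : M, (ℓ : PowerSeries ℤ_[ℓ]) ^ k • x = 0) :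
    Finite M := by
  have := finite_quotient_span_pow_X_pow ℓ k (ℓ ^ n * k)
  refine finite_of_isTorsionBySet
    (Ideal.span {(ℓ : PowerSeries ℤ_[ℓ]) ^ k, PowerSeries.X ^ (ℓ ^ n * k)}) ?_
  rw [Module.isTorsionBySet_iff_subset_annihilator, SetLike.coe_subset_coe, Ideal.span_le]
  have hℓ' : (ℓ : PowerSeries ℤ_[ℓ]) ^ k ∈ Module.annihilator (PowerSeries ℤ_[ℓ]) M :=
    Module.mem_annihilator.2 hℓ
  rintro _ (rfl | rfl)
  · exact hℓ'
  · refine Ideal.span_le.2 ?_ (X_pow_mem_span_omega_pow ℓ n k)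
    rintro _ (rfl | rfl)
    exacts [Module.mem_annihilator.2 hω, hℓ']

/-- Let `ℓ` be a prime, `Λ = ℤℓ[[X]]`, and `T` a finitely generated torsion
`Λ`-module with largest finite submodule `F`.  Then there exists `N` such that
for all `m ≥ n ≥ N`, every `t : T` with `ν_{n,m} • t = 0` lies in `F`; that is,
`T[ν_{n,m}] ⊆ F`. -/
theorem stmt7 (ℓ : ℕ) [Fact (Nat.Prime ℓ)]
    (T : Type) [AddCommGroup T] [Module (PowerSeries ℤ_[ℓ]) T]
    [Module.Finite (PowerSeries ℤ_[ℓ]) T]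
    (htors : Module.IsTorsion (PowerSeries ℤ_[ℓ]) T)
    (F : Submodule (PowerSeries ℤ_[ℓ]) T) (hFfin : (F : Set T).Finite)
    (hFmax : ∀ G : Submodule (PowerSeries ℤ_[ℓ]) T, (G : Set T).Finite → G ≤ F) :
    ∃ N : ℕ, ∀ n m : ℕ, N ≤ n → n ≤ m →
      Submodule.torsionBy (PowerSeries ℤ_[ℓ]) T (nu ℓ n m) ≤ F := by
  let K : ℕ →o Submodule (PowerSeries ℤ_[ℓ]) T :=
    ⟨fun n ↦ Submodule.torsionBy _ T (omega ℓ n), fun _ _ h ↦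
      Submodule.torsionBy_le_torsionBy_of_dvd _ _ (omega_dvd_omega ℓ h)⟩
  obtain ⟨N, hN⟩ := monotone_stabilizes_iff_noetherian.2
    (inferInstance : IsNoetherian (PowerSeries ℤ_[ℓ]) T) K
  refine ⟨N, fun n m hn hnm ↦ hFmax _ ?_⟩
  have hω : ∀ t : T, nu ℓ n m • t = 0 → omega ℓ n • t = 0 := fun t ht ↦ by
    have hm : t ∈ K m := by
      change omega ℓ m • t = 0
      rw [← nu_mul_omega ℓ hnm, mul_comm, mul_smul, ht, smul_zero]
    rw [← hN m (hn.trans hnm), hN n hn] at hm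
    exact hm
  have hℓ : ∀ t : T, nu ℓ n m • t = 0 → (ℓ : PowerSeries ℤ_[ℓ]) ^ (m - n) • t = 0 := fun t ht ↦ by
    obtain ⟨c, hc⟩ := omega_dvd_nu_sub ℓ n m
    rw [← sub_sub_cancel (nu ℓ n m) ((ℓ : PowerSeries ℤ_[ℓ]) ^ (m - n)), hc, sub_smul, ht,
      mul_comm, mul_smul, hω t ht, smul_zero, sub_zero]
  have := finite_of_omega_smul_of_pow_smul ℓ (M := Submodule.torsionBy _ T (nu ℓ n m)) n (m - n)
    (fun x ↦ Subtype.ext (hω x x.2)) (fun x ↦ Subtype.ext (hℓ x x.2))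
  exact Set.toFinite _
end
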